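/- Under these hypotheses, for every integer N ≥ 2 and every function ι : {1,…,N} → {1,…,d}, writing ∂(φ,J) for the mixed partial derivative (∏_{j∈J} ∂/∂a_{ι(j)}) φ evaluated at a = 0 for a non-empty subset J ⊆ {1,…,N}, the following recursion holds: 0 = Σ_{h=1}^{N} Σ_{k=1}^{N−1} (γ_{ι(h)})_k·α^{γ_{ι(h)}−k}·Σ_{P ∈ S({1,…,N}∖{h},k)} ∏_{B ∈ P} ∂(φ,B) + Σ_{k=2}^{N} k!·c_k·Σ_{P ∈ S({1,…,N},k)} ∏_{B ∈ P} ∂(φ,B) + c₁·∂(φ,{1,…,N}), where α^{γ−k} denotes the principal-branch power. -/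

import Mathlib

open Finset Complex

noncomputable def fallFac (z : ℂ) (k : ℕ) : ℂ := ∏ j ∈ Finset.range k, (z - j)

/-- Unordered partitions of the finite set `H` into `k` non-empty pairwise
disjoint blocks. -/
def setPartitions {β : Type*} [DecidableEq β] (H : Finset β) (k : ℕ) :
    Finset (Finset (Finset β)) :=
  H.powerset.powerset.filter fun P =>
    P.card = k ∧ (∀ B ∈ P, B.Nonempty) ∧
      (∀ B ∈ P, ∀ B' ∈ P, B ≠ B' → Disjoint B B') ∧ P.sup id = H

/-- The partial derivative ∂/∂aᵢ of a function ℂ^d → ℂ. -/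
noncomputable def pderivC {d : ℕ} (i : Fin d) (ψ : (Fin d → ℂ) → ℂ) :
    (Fin d → ℂ) → ℂ :=
  fun a => deriv (fun t => ψ (Function.update a i t)) (a i)

/-- The mixed partial derivative (∂/∂a₁)^{n₁} ⋯ (∂/∂a_d)^{n_d} ψ. -/
noncomputable def mixedPartial {d : ℕ} (n : Fin d → ℕ) (ψ : (Fin d → ℂ) → ℂ) :
    (Fin d → ℂ) → ℂ :=
  ((List.ofFn fun i : Fin d => (pderivC i)^[n i]).foldr (· ∘ ·) id) ψ

/-- ∂(φ, J): the mixed partial derivative (∏_{j ∈ J} ∂/∂a_{ι j}) φ evaluated at 0,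
i.e. the mixed partial for the multi-index n with n i = #{j ∈ J : ι j = i}. -/
noncomputable def partialOverSet {d N : ℕ} (φ : (Fin d → ℂ) → ℂ) (ι : Fin N → Fin d)
    (J : Finset (Fin N)) : ℂ :=
  mixedPartial (fun i => (J.filter fun j => ι j = i).card) φ 0

/-- The set partitions of `H` into any number of blocks. -/
def allSetPartitions {β : Type*} [DecidableEq β] (H : Finset β) : Finset (Finset (Finset β)) :=
  H.powerset.powerset.filter fun P =>
    (∀ B ∈ P, B.Nonempty) ∧ (∀ B ∈ P, ∀ B' ∈ P, B ≠ B' → Disjoint B B') ∧ P.sup id = H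

lemma mem_allSetPartitions {β : Type*} [DecidableEq β] {H : Finset β} {P : Finset (Finset β)} :
    P ∈ allSetPartitions H ↔ (∀ B ∈ P, B.Nonempty) ∧
      (∀ B ∈ P, ∀ B' ∈ P, ∀ x, x ∈ B → x ∈ B' → B = B') ∧ ∀ x, x ∈ H ↔ ∃ B ∈ P, x ∈ B := by
  have hsup : P.sup id = H ↔ ∀ x, x ∈ H ↔ ∃ B ∈ P, x ∈ B := by
    simp only [Finset.ext_iff, Finset.mem_sup, id]
    exact forall_congr' fun x => Iff.comm
  have hdisj : (∀ B ∈ P, ∀ B' ∈ P, B ≠ B' → Disjoint B B') ↔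
      ∀ B ∈ P, ∀ B' ∈ P, ∀ x, x ∈ B → x ∈ B' → B = B' := by
    simp only [Finset.disjoint_left]
    grind
  simp only [allSetPartitions, Finset.mem_filter, Finset.mem_powerset, hsup, hdisj]
  refine ⟨And.right, fun h => ⟨fun B hB => ?_, h⟩⟩
  exact Finset.mem_powerset.2 fun x hx => (h.2.2 x).2 ⟨B, hB, hx⟩

lemma setPartitions_eq_filter {β : Type*} [DecidableEq β] (H : Finset β) (k : ℕ) :
    setPartitions H k = (allSetPartitions H).filter fun P => P.card = k := by
  ext P
  simp only [setPartitions, allSetPartitions, Finset.mem_filter]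
  tauto

lemma allSetPartitions_empty {β : Type*} [DecidableEq β] :
    allSetPartitions (∅ : Finset β) = {∅} := by
  ext P
  rw [mem_allSetPartitions, Finset.mem_singleton]
  constructor
  · rintro ⟨h1, -, h3⟩
    refine Finset.eq_empty_of_forall_notMem fun B hB => ?_
    obtain ⟨x, hx⟩ := h1 B hB
    simpa using (h3 x).2 ⟨B, hB, hx⟩
  · rintro rfl
    simp

lemma card_le_of_mem_allSetPartitions {β : Type*} [DecidableEq β] {H : Finset β}
    {P : Finset (Finset β)} (hP : P ∈ allSetPartitions H) : P.card ≤ H.card := by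
  rw [mem_allSetPartitions] at hP
  obtain ⟨h1, h2, h3⟩ := hP
  rcases P.eq_empty_or_nonempty with rfl | ⟨C, hC⟩
  · simp
  have : Nonempty β := ⟨(h1 C hC).choose⟩
  choose! f hf using h1
  exact Finset.card_le_card_of_injOn f (fun B hB => (h3 _).2 ⟨B, hB, hf B hB⟩)
    fun B hB B' hB' h => h2 B hB B' hB' _ (hf B hB) (h ▸ hf B' hB')

lemma one_le_card_of_mem_allSetPartitions {β : Type*} [DecidableEq β] {H : Finset β}
    (hH : H.Nonempty) {P : Finset (Finset β)} (hP : P ∈ allSetPartitions H) : 1 ≤ P.card := by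
  rw [mem_allSetPartitions] at hP
  obtain ⟨x, hx⟩ := hH
  obtain ⟨B, hB, -⟩ := (hP.2.2 x).1 hx
  exact Finset.card_pos.2 ⟨B, hB⟩

/-- A sum over all set partitions, grouped by the number of blocks. -/
lemma sum_allSetPartitions_eq_sum_Icc {β : Type*} [DecidableEq β] {H : Finset β}
    (hH : H.Nonempty) (G : ℕ → ℂ) (F : Finset (Finset β) → ℂ) :
    ∑ P ∈ allSetPartitions H, G P.card * F P =
      ∑ k ∈ Finset.Icc 1 H.card, G k * ∑ P ∈ setPartitions H k, F P := by
  rw [← Finset.sum_fiberwise_of_maps_to (t := Finset.Icc 1 H.card) (g := Finset.card)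
    fun P hP => Finset.mem_Icc.2
      ⟨one_le_card_of_mem_allSetPartitions hH hP, card_le_of_mem_allSetPartitions hP⟩]
  refine Finset.sum_congr rfl fun k _ => ?_
  rw [setPartitions_eq_filter, Finset.mul_sum]
  exact Finset.sum_congr rfl fun P hP => by rw [(Finset.mem_filter.1 hP).2]

lemma notMem_block {β : Type*} [DecidableEq β] {J : Finset β} {j : β} (hj : j ∉ J)
    {P : Finset (Finset β)} (hP : P ∈ allSetPartitions J) {B : Finset β} (hB : B ∈ P) : j ∉ B :=
  fun h => hj (((mem_allSetPartitions.1 hP).2.2 j).2 ⟨B, hB, h⟩)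

/-- A set partition of `insert j J` arises from a unique one of `J`, either by adding the block
`{j}` or by adding `j` to one of the blocks. -/
lemma sum_allSetPartitions_insert {β M : Type*} [DecidableEq β] [AddCommMonoid M]
    {J : Finset β} {j : β} (hj : j ∉ J) (F : Finset (Finset β) → M) :
    ∑ P ∈ allSetPartitions (insert j J), F P =
      ∑ P ∈ allSetPartitions J,
        (F (insert {j} P) + ∑ B ∈ P, F (insert (insert j B) (P.erase B))) := by
  rw [← Finset.sum_filter_add_sum_filter_not _ (fun P => {j} ∈ P), Finset.sum_add_distrib]
  congr 1
  · refine Finset.sum_bij' (fun P _ => P.erase {j}) (fun P _ => insert {j} P) ?_ ?_ ?_ ?_ ?_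
    · intro P hP
      rw [Finset.mem_filter, mem_allSetPartitions] at hP
      obtain ⟨⟨h1, h2, h3⟩, h4⟩ := hP
      rw [mem_allSetPartitions]
      refine ⟨by grind, by grind, fun x => ⟨fun hx => ?_, ?_⟩⟩
      · obtain ⟨B, hB, hxB⟩ := (h3 x).1 (by grind)
        exact ⟨B, by grind, hxB⟩
      · rintro ⟨B, hB, hxB⟩
        have := (h3 x).2 ⟨B, by grind, hxB⟩
        have h5 := h2 B (by grind) {j} h4 j
        grind
    · intro P hP
      have hb := fun B => notMem_block hj hP (B := B)
      rw [mem_allSetPartitions] at hP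
      obtain ⟨h1, h2, h3⟩ := hP
      rw [Finset.mem_filter, mem_allSetPartitions]
      refine ⟨⟨by grind, by grind, fun x => ?_⟩, by grind⟩
      simp [h3]
    · intro P hP
      exact Finset.insert_erase (Finset.mem_filter.1 hP).2
    · intro P hP
      exact Finset.erase_insert fun h => notMem_block hj hP h (by simp)
    · intro P hP
      rw [Finset.insert_erase (Finset.mem_filter.1 hP).2]
  · rw [Finset.sum_sigma']
    symm
    refine Finset.sum_nbij (fun x => insert (insert j x.2) (x.1.erase x.2)) ?_ ?_ ?_ ?_
    · rintro ⟨P, B⟩ hPB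
      rw [Finset.mem_sigma] at hPB
      obtain ⟨hP, hB⟩ := hPB
      dsimp only at hP hB ⊢
      have hb := fun B => notMem_block hj hP (B := B)
      rw [mem_allSetPartitions] at hP
      obtain ⟨h1, h2, h3⟩ := hP
      rw [Finset.mem_filter, mem_allSetPartitions]
      refine ⟨⟨?_, ?_, fun x => ?_⟩, ?_⟩
      · grind
      · intro C hC C' hC' x hx hx'
        have := fun D hD => h2 B hB D hD x
        have := fun D hD D' hD' => h2 D hD D' hD' x
        grind
      · rw [Finset.mem_insert, h3]
        constructor
        · rintro (rfl | ⟨C, hC, hx⟩)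
          · exact ⟨_, Finset.mem_insert_self _ _, by simp⟩
          · by_cases hCB : C = B
            · exact ⟨_, Finset.mem_insert_self _ _, by simp [← hCB, hx]⟩
            · exact ⟨C, by grind, hx⟩
        · grind
      · obtain ⟨y, hy⟩ := h1 B hB
        have := hb B hB
        intro h
        rw [Finset.mem_insert] at h
        rcases h with h | h
        · have : y ∈ ({j} : Finset β) := h ▸ Finset.mem_insert_of_mem hy
          grind
        · exact hb {j} (Finset.mem_of_mem_erase h) (by simp)
    · rintro ⟨P, B⟩ hPB ⟨P', B'⟩ hPB' h
      simp only [Finset.coe_sigma, Set.mem_sigma_iff, Finset.mem_coe] at hPB hPB' h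
      have hb := fun B => notMem_block hj hPB.1 (B := B)
      have hb' := fun B => notMem_block hj hPB'.1 (B := B)
      have h1 : insert j B = insert j B' := by
        have : insert j B ∈ insert (insert j B') (P'.erase B') := h ▸ Finset.mem_insert_self _ _
        have := hb' (insert j B)
        grind
      have hBB : B = B' := by
        rw [← Finset.erase_insert (hb B hPB.2), h1, Finset.erase_insert (hb' B' hPB'.2)]
      subst hBB
      have h2 : P.erase B = P'.erase B := by
        have hn : insert j B ∉ P.erase B := fun h =>
          hb _ (Finset.mem_of_mem_erase h) (by simp)
        have hn' : insert j B ∉ P'.erase B := fun h =>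
          hb' _ (Finset.mem_of_mem_erase h) (by simp)
        rw [← Finset.erase_insert hn, h, Finset.erase_insert hn']
      have : P = P' := by
        rw [← Finset.insert_erase hPB.2, h2, Finset.insert_erase hPB'.2]
      subst this
      rfl
    · intro Q hQ
      rw [Finset.mem_coe, Finset.mem_filter, mem_allSetPartitions] at hQ
      obtain ⟨⟨h1, h2, h3⟩, h4⟩ := hQ
      obtain ⟨C, hC, hjC⟩ := (h3 j).1 (by simp)
      have hn : C.erase j ∉ Q := by
        intro h
        obtain ⟨y, hy⟩ := h1 _ h
        have := h2 _ h C hC y hy (Finset.mem_of_mem_erase hy)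
        grind
      have hne : (C.erase j).Nonempty := by
        rw [Finset.nonempty_iff_ne_empty]
        intro h
        rw [Finset.erase_eq_empty_iff] at h
        grind
      refine ⟨⟨insert (C.erase j) (Q.erase C), C.erase j⟩, ?_, ?_⟩
      · simp only [Finset.coe_sigma, Set.mem_sigma_iff, Finset.mem_coe]
        refine ⟨?_, Finset.mem_insert_self _ _⟩
        rw [mem_allSetPartitions]
        refine ⟨by grind, ?_, fun x => ⟨fun hx => ?_, ?_⟩⟩
        · intro D hD D' hD' x hx hx'
          have := fun D hD D' hD' => h2 D hD D' hD' x
          grind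
        · obtain ⟨D, hD, hxD⟩ := (h3 x).1 (by grind)
          by_cases hDC : D = C
          · exact ⟨_, Finset.mem_insert_self _ _, by grind⟩
          · exact ⟨D, by grind, hxD⟩
        · rintro ⟨D, hD, hxD⟩
          rw [Finset.mem_insert] at hD
          rcases hD with rfl | hD
          · have := (h3 x).2 ⟨C, hC, by grind⟩
            grind
          · have := (h3 x).2 ⟨D, by grind, hxD⟩
            have := h2 D (by grind) C hC j
            grind
      · have hn' : C.erase j ∉ Q.erase C := fun h => hn (Finset.mem_of_mem_erase h)
        simp only [Finset.erase_insert hn', Finset.insert_erase hjC, Finset.insert_erase hC]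
    · intro x _
      rfl

section PartialDerivatives

variable {d : ℕ} {U : Set (Fin d → ℂ)} {ψ ψ' : (Fin d → ℂ) → ℂ}

lemma hasDerivAt_update_fderiv (hU : IsOpen U) (hψ : ContDiffOn ℂ (⊤ : ℕ∞) ψ U)
    (i : Fin d) {a : Fin d → ℂ} (ha : a ∈ U) :
    HasDerivAt (fun t => ψ (Function.update a i t)) (fderiv ℂ ψ a (Pi.single i 1)) (a i) := by
  have h1 : DifferentiableAt ℂ ψ (Function.update a i (a i)) := by
    rw [Function.update_eq_self]
    exact (hψ.contDiffAt (hU.mem_nhds ha)).differentiableAt (by simp)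
  have h2 := h1.hasFDerivAt.comp_hasDerivAt (a i) (hasDerivAt_update a i (a i))
  rwa [Function.update_eq_self] at h2

lemma pderivC_eq_fderiv (hU : IsOpen U) (hψ : ContDiffOn ℂ (⊤ : ℕ∞) ψ U)
    (i : Fin d) {a : Fin d → ℂ} (ha : a ∈ U) :
    pderivC i ψ a = fderiv ℂ ψ a (Pi.single i 1) :=
  (hasDerivAt_update_fderiv hU hψ i ha).deriv

lemma hasDerivAt_pderivC (hU : IsOpen U) (hψ : ContDiffOn ℂ (⊤ : ℕ∞) ψ U)
    (i : Fin d) {a : Fin d → ℂ} (ha : a ∈ U) :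
    HasDerivAt (fun t => ψ (Function.update a i t)) (pderivC i ψ a) (a i) :=
  pderivC_eq_fderiv hU hψ i ha ▸ hasDerivAt_update_fderiv hU hψ i ha

lemma pderivC_congr (hU : IsOpen U) (h : Set.EqOn ψ ψ' U) (i : Fin d) :
    Set.EqOn (pderivC i ψ) (pderivC i ψ') U := by
  intro a ha
  refine Filter.EventuallyEq.deriv_eq ?_
  have hc : ContinuousAt (fun t => Function.update a i t) (a i) :=
    (hasDerivAt_update a i (a i)).continuousAt
  filter_upwards [hc.preimage_mem_nhds (hU.mem_nhds (by simpa using ha))] with t ht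
  exact h ht

lemma contDiffOn_pderivC (hU : IsOpen U) (hψ : ContDiffOn ℂ (⊤ : ℕ∞) ψ U) (i : Fin d) :
    ContDiffOn ℂ (⊤ : ℕ∞) (pderivC i ψ) U :=
  ((hψ.fderiv_of_isOpen hU (by simp)).clm_apply contDiffOn_const).congr
    fun _ ha => pderivC_eq_fderiv hU hψ i ha

lemma pderivC_comm (hU : IsOpen U) (hψ : ContDiffOn ℂ (⊤ : ℕ∞) ψ U) (i j : Fin d) :
    Set.EqOn (pderivC i (pderivC j ψ)) (pderivC j (pderivC i ψ)) U := by
  have key : ∀ i j : Fin d, ∀ a ∈ U, pderivC i (pderivC j ψ) a =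
      fderiv ℂ (fderiv ℂ ψ) a (Pi.single i 1) (Pi.single j 1) := by
    intro i j a ha
    rw [pderivC_eq_fderiv hU (contDiffOn_pderivC hU hψ j) i ha]
    have h1 : pderivC j ψ =ᶠ[nhds a] fun b => fderiv ℂ ψ b (Pi.single j 1) := by
      filter_upwards [hU.mem_nhds ha] with b hb using pderivC_eq_fderiv hU hψ j hb
    have h2 : DifferentiableAt ℂ (fderiv ℂ ψ) a :=
      ((hψ.fderiv_of_isOpen (m := (⊤ : ℕ∞)) hU (by simp)).contDiffAt
        (hU.mem_nhds ha)).differentiableAt (by simp)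
    rw [h1.fderiv_eq, fderiv_clm_apply h2 (differentiableAt_const _)]
    simp
  intro a ha
  rw [key i j a ha, key j i a ha]
  exact ((hψ.contDiffAt (hU.mem_nhds ha)).isSymmSndFDerivAt
    (by simpa using WithTop.coe_le_coe.2 (le_top : (2 : ℕ∞) ≤ ⊤))) _ _

/-- The iterated partial derivative of `ψ` along a list of coordinates. -/
noncomputable def pderivList (l : List (Fin d)) (ψ : (Fin d → ℂ) → ℂ) : (Fin d → ℂ) → ℂ :=
  l.foldr pderivC ψ

lemma contDiffOn_pderivList (hU : IsOpen U) (hψ : ContDiffOn ℂ (⊤ : ℕ∞) ψ U)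
    (l : List (Fin d)) : ContDiffOn ℂ (⊤ : ℕ∞) (pderivList l ψ) U := by
  induction l with
  | nil => exact hψ
  | cons i l ih => exact contDiffOn_pderivC hU ih i

lemma pderivList_congr (hU : IsOpen U) (h : Set.EqOn ψ ψ' U) (l : List (Fin d)) :
    Set.EqOn (pderivList l ψ) (pderivList l ψ') U := by
  induction l with
  | nil => exact h
  | cons i l ih => exact pderivC_congr hU ih i

lemma pderivList_perm (hU : IsOpen U) (hψ : ContDiffOn ℂ (⊤ : ℕ∞) ψ U) {l l' : List (Fin d)}
    (h : l.Perm l') : Set.EqOn (pderivList l ψ) (pderivList l' ψ) U := by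
  induction h with
  | nil => exact fun _ _ => rfl
  | cons i _ ih => exact pderivC_congr hU ih i
  | swap i j l => exact pderivC_comm hU (contDiffOn_pderivList hU hψ l) j i
  | trans _ _ ih ih' => exact ih.trans ih'

lemma pderivList_zero (l : List (Fin d)) : pderivList l (fun _ => 0) = fun _ => 0 := by
  induction l with
  | nil => rfl
  | cons i l ih =>
    change pderivC i (pderivList l _) = _
    rw [ih]
    funext a
    simp [pderivC]

lemma mixedPartial_eq_pderivList (n : Fin d → ℕ) (ψ : (Fin d → ℂ) → ℂ) :
    mixedPartial n ψ =
      pderivList (List.ofFn fun i => List.replicate (n i) i).flatten ψ := by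
  have h1 : ∀ (i : Fin d) (m : ℕ) (χ : (Fin d → ℂ) → ℂ),
      (pderivC i)^[m] χ = (List.replicate m i).foldr pderivC χ := by
    intro i m χ
    induction m with
    | zero => rfl
    | succ m ih => rw [Function.iterate_succ_apply', ih, List.replicate_succ, List.foldr_cons]
  have h2 : ∀ l : List (Fin d),
      ((l.map fun i => (pderivC i)^[n i]).foldr (· ∘ ·) id) ψ =
        pderivList (l.map fun i => List.replicate (n i) i).flatten ψ := by
    intro l
    induction l with
    | nil => rfl
    | cons i l ih =>
      simp only [pderivList] at ih
      simp only [pderivList, List.map_cons, List.foldr_cons, List.flatten_cons,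
        List.foldr_append, Function.comp_apply, ih, h1]
  simpa [mixedPartial, List.ofFn_eq_map] using h2 (List.finRange d)

variable {N : ℕ}

/-- The iterated partial derivative of `ψ` along the coordinates `ι j`, `j ∈ J`. -/
noncomputable def pderivSet (ι : Fin N → Fin d) (J : Finset (Fin N)) (ψ : (Fin d → ℂ) → ℂ) :
    (Fin d → ℂ) → ℂ :=
  pderivList (J.toList.map ι) ψ

lemma partialOverSet_eq_pderivSet (hU : IsOpen U) (hψ : ContDiffOn ℂ (⊤ : ℕ∞) ψ U)
    (h0 : (0 : Fin d → ℂ) ∈ U) (ι : Fin N → Fin d) (J : Finset (Fin N)) :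
    partialOverSet ψ ι J = pderivSet ι J ψ 0 := by
  rw [partialOverSet, mixedPartial_eq_pderivList, pderivSet]
  refine pderivList_perm hU hψ (List.perm_iff_count.2 fun i => ?_) h0
  have h1 : (J.toList.map ι).count i = (J.filter fun j => ι j = i).card := by
    rw [← Multiset.coe_count, ← Multiset.map_coe, Finset.coe_toList, Multiset.count_map]
    simp only [eq_comm]
    rfl
  rw [h1, List.count_flatten, List.map_ofFn, List.sum_ofFn]
  simp [List.count_replicate]

lemma contDiffOn_pderivSet (hU : IsOpen U) (hψ : ContDiffOn ℂ (⊤ : ℕ∞) ψ U)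
    (ι : Fin N → Fin d) (J : Finset (Fin N)) : ContDiffOn ℂ (⊤ : ℕ∞) (pderivSet ι J ψ) U :=
  contDiffOn_pderivList hU hψ _

lemma pderivSet_empty (ι : Fin N → Fin d) : pderivSet ι ∅ ψ = ψ := by
  simp [pderivSet, pderivList]

lemma pderivSet_insert (hU : IsOpen U) (hψ : ContDiffOn ℂ (⊤ : ℕ∞) ψ U)
    (ι : Fin N → Fin d) {J : Finset (Fin N)} {j : Fin N} (hj : j ∉ J) :
    Set.EqOn (pderivSet ι (insert j J) ψ) (pderivC (ι j) (pderivSet ι J ψ)) U :=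
  pderivList_perm (l' := ι j :: J.toList.map ι) hU hψ ((Finset.toList_insert hj).map ι)

lemma hasDerivAt_pderivSet (hU : IsOpen U) (hψ : ContDiffOn ℂ (⊤ : ℕ∞) ψ U)
    (ι : Fin N → Fin d) {J : Finset (Fin N)} {j : Fin N} (hj : j ∉ J)
    {a : Fin d → ℂ} (ha : a ∈ U) :
    HasDerivAt (fun t => pderivSet ι J ψ (Function.update a (ι j) t))
      (pderivSet ι (insert j J) ψ a) (a (ι j)) :=
  pderivSet_insert hU hψ ι hj ha ▸ hasDerivAt_pderivC hU (contDiffOn_pderivSet hU hψ ι J) (ι j) ha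

/-- To differentiate a formula for `pderivSet ι J ψ` it suffices to differentiate it along the
line through `a` in the direction `ι j`. -/
lemma pderivSet_insert_eq_of_hasDerivAt (hU : IsOpen U) (hψ : ContDiffOn ℂ (⊤ : ℕ∞) ψ U)
    (ι : Fin N → Fin d) {J : Finset (Fin N)} {j : Fin N} (hj : j ∉ J)
    (h : Set.EqOn (pderivSet ι J ψ) ψ' U) {a : Fin d → ℂ} (ha : a ∈ U) {D : ℂ}
    (hD : HasDerivAt (fun t => ψ' (Function.update a (ι j) t)) D (a (ι j))) :
    pderivSet ι (insert j J) ψ a = D := by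
  rw [pderivSet_insert hU hψ ι hj ha, pderivC_congr hU h (ι j) ha]
  exact hD.deriv

/-- **Faà di Bruno's formula** for iterated partial derivatives, where `G k` is the `k`-th
derivative of `G 0`. -/
lemma pderivSet_comp (hU : IsOpen U) (hψ : ContDiffOn ℂ (⊤ : ℕ∞) ψ U) (G : ℕ → ℂ → ℂ)
    (hG : ∀ k, ∀ a ∈ U, HasDerivAt (G k) (G (k + 1) (ψ a)) (ψ a))
    (hGψ : ContDiffOn ℂ (⊤ : ℕ∞) (fun a => G 0 (ψ a)) U)
    (ι : Fin N → Fin d) (J : Finset (Fin N)) :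
    Set.EqOn (pderivSet ι J fun a => G 0 (ψ a))
      (fun a => ∑ P ∈ allSetPartitions J, G P.card (ψ a) * ∏ B ∈ P, pderivSet ι B ψ a) U := by
  induction J using Finset.induction_on with
  | empty =>
    intro a _
    simp [allSetPartitions_empty, pderivSet_empty]
  | insert j J hj ih =>
    intro a ha
    refine pderivSet_insert_eq_of_hasDerivAt hU hGψ ι hj ih ha ?_
    beta_reduce
    rw [sum_allSetPartitions_insert hj]
    refine HasDerivAt.fun_sum fun P hP => ?_
    have hb := fun B => notMem_block hj hP (B := B)
    have hψj : HasDerivAt (fun t => ψ (Function.update a (ι j) t))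
        (pderivSet ι {j} ψ a) (a (ι j)) := by
      have := hasDerivAt_pderivSet hU hψ ι (Finset.notMem_empty j) ha
      simpa only [pderivSet_empty, insert_empty_eq] using this
    have hGj : HasDerivAt (fun t => G P.card (ψ (Function.update a (ι j) t)))
        (G (P.card + 1) (ψ a) * pderivSet ι {j} ψ a) (a (ι j)) := by
      refine HasDerivAt.comp (a (ι j)) (h₂ := G P.card) ?_ hψj
      simpa using hG P.card a ha
    have hprod := HasDerivAt.fun_finsetProd (u := P) (x := a (ι j))
      (f := fun B t => pderivSet ι B ψ (Function.update a (ι j) t))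
      fun B hB => hasDerivAt_pderivSet hU hψ ι (hb B hB) ha
    refine (hGj.mul hprod).congr_deriv ?_
    simp only [Function.update_eq_self, smul_eq_mul]
    have hjP : {j} ∉ P := fun h => hb _ h (by simp)
    rw [Finset.card_insert_of_notMem hjP, Finset.prod_insert hjP, Finset.mul_sum]
    congr 1
    · ring
    · refine Finset.sum_congr rfl fun B hB => ?_
      have hn : insert j B ∉ P.erase B := fun h => hb _ (Finset.mem_of_mem_erase h) (by simp)
      rw [Finset.card_insert_of_notMem hn, Finset.card_erase_add_one hB, Finset.prod_insert hn]
      ring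

/-- Leibniz rule for `χ + ∑ i, a i * F i`. -/
lemma pderivSet_add_sum_coord_mul (hU : IsOpen U) {χ : (Fin d → ℂ) → ℂ}
    {F : Fin d → (Fin d → ℂ) → ℂ} (hχ : ContDiffOn ℂ (⊤ : ℕ∞) χ U)
    (hF : ∀ i, ContDiffOn ℂ (⊤ : ℕ∞) (F i) U) (ι : Fin N → Fin d) (J : Finset (Fin N)) :
    Set.EqOn (pderivSet ι J fun a => χ a + ∑ i, a i * F i a)
      (fun a => pderivSet ι J χ a + ∑ i, a i * pderivSet ι J (F i) a +
        ∑ h ∈ J, pderivSet ι (J.erase h) (F (ι h)) a) U := by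
  have hs : ContDiffOn ℂ (⊤ : ℕ∞) (fun a => χ a + ∑ i, a i * F i a) U :=
    hχ.add (ContDiffOn.sum fun i _ => (contDiff_apply ℂ ℂ i).contDiffOn.mul (hF i))
  induction J using Finset.induction_on with
  | empty =>
    intro a _
    simp [pderivSet_empty]
  | insert j J hj ih =>
    intro a ha
    refine pderivSet_insert_eq_of_hasDerivAt hU hs ι hj ih ha ?_
    have hcoord : ∀ i, HasDerivAt (fun t => Function.update a (ι j) t i)
        ((Pi.single (ι j) 1 : Fin d → ℂ) i) (a (ι j)) :=
      hasDerivAt_pi.1 (hasDerivAt_update a (ι j) (a (ι j)))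
    have h2 := HasDerivAt.fun_sum (u := Finset.univ) fun i _ =>
      (hcoord i).fun_mul (hasDerivAt_pderivSet hU (hF i) ι hj ha)
    have h3 := HasDerivAt.fun_sum (u := J) fun h _ =>
      hasDerivAt_pderivSet hU (hF (ι h)) ι (J := J.erase h)
        (fun hm => hj (Finset.mem_of_mem_erase hm)) ha
    refine (((hasDerivAt_pderivSet hU hχ ι hj ha).fun_add h2).fun_add h3).congr_deriv ?_
    beta_reduce
    rw [Finset.sum_insert hj, Finset.erase_insert hj]
    have h4 : ∑ h ∈ J, pderivSet ι ((insert j J).erase h) (F (ι h)) a =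
        ∑ h ∈ J, pderivSet ι (insert j (J.erase h)) (F (ι h)) a :=
      Finset.sum_congr rfl fun h hh => by
        have hjh : j ≠ h := fun e => hj (e ▸ hh)
        rw [Finset.erase_insert_of_ne hjh]
    rw [h4]
    simp only [Function.update_eq_self, Finset.sum_add_distrib, Pi.single_apply, ite_mul, one_mul,
      zero_mul, Finset.sum_ite_eq', Finset.mem_univ, if_true]
    ring

end PartialDerivatives

lemma fallFac_succ (z : ℂ) (k : ℕ) : fallFac z (k + 1) = fallFac z k * (z - k) :=
  Finset.prod_range_succ _ _

lemma hasDerivAt_fallFac_mul_cpow (γ : ℂ) (k : ℕ) {z : ℂ} (hz : z ∈ Complex.slitPlane) :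
    HasDerivAt (fun w => fallFac γ k * w ^ (γ - (k : ℂ)))
      (fallFac γ (k + 1) * z ^ (γ - ((k + 1 : ℕ) : ℂ))) z := by
  refine (((hasDerivAt_id z).cpow_const (c := γ - k) hz).const_mul (fallFac γ k)).congr_deriv ?_
  rw [fallFac_succ, Nat.cast_add, Nat.cast_one, ← sub_sub]
  simp only [id]
  ring

lemma hasDerivAt_iteratedDeriv {g : ℂ → ℂ} {z : ℂ} (hg : AnalyticAt ℂ g z) (k : ℕ) :
    HasDerivAt (iteratedDeriv k g) (iteratedDeriv (k + 1) g z) z := by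
  rw [iteratedDeriv_succ]
  refine DifferentiableAt.hasDerivAt ?_
  rw [iteratedDeriv_eq_iterate]
  exact (hg.iterated_deriv k).differentiableAt

theorem derivative_recursion
    {d : ℕ} (hd : 1 ≤ d) (γ : Fin d → ℂ) (α : ℂ) (hα : α ∈ Complex.slitPlane)
    (g : ℂ → ℂ) (hg : AnalyticAt ℂ g α) (hgα : g α = 0) (hg' : deriv g α ≠ 0)
    (c : ℕ → ℂ) (hc : ∀ k, c k = iteratedDeriv k g α / (Nat.factorial k : ℂ))
    (U : Set (Fin d → ℂ)) (hU : IsOpen U) (h0U : (0 : Fin d → ℂ) ∈ U)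
    (φ : (Fin d → ℂ) → ℂ) (hφ : ContDiffOn ℂ (⊤ : ℕ∞) φ U)
    (hφ0 : φ 0 = α) (hφslit : ∀ a ∈ U, φ a ∈ Complex.slitPlane)
    (hzero : ∀ a ∈ U, g (φ a) + ∑ i, a i * φ a ^ γ i = 0)
    (N : ℕ) (hN : 2 ≤ N) (ι : Fin N → Fin d) :
    0 =
      (∑ h : Fin N, ∑ k ∈ Finset.Icc 1 (N - 1),
          fallFac (γ (ι h)) k * α ^ (γ (ι h) - (k : ℂ)) *
            ∑ P ∈ setPartitions (Finset.univ.erase h) k,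
              ∏ B ∈ P, partialOverSet φ ι B)
      + (∑ k ∈ Finset.Icc 2 N,
          ((Nat.factorial k) : ℂ) * c k *
            ∑ P ∈ setPartitions (Finset.univ : Finset (Fin N)) k,
              ∏ B ∈ P, partialOverSet φ ι B)
      + c 1 * partialOverSet φ ι Finset.univ := by
  have hUN : (Finset.univ : Finset (Fin N)).Nonempty :=
    Finset.card_pos.1 (by rw [Finset.card_univ, Fintype.card_fin]; omega)
  set V : Set (Fin d → ℂ) := U ∩ φ ⁻¹' {z | AnalyticAt ℂ g z}
  have hV : IsOpen V := hφ.continuousOn.isOpen_inter_preimage hU (isOpen_analyticAt ℂ g)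
  have h0V : (0 : Fin d → ℂ) ∈ V := ⟨h0U, by simpa [hφ0] using hg⟩
  have hφV : ContDiffOn ℂ (⊤ : ℕ∞) φ V := hφ.mono Set.inter_subset_left
  have hgφ : ContDiffOn ℂ (⊤ : ℕ∞) (fun a => g (φ a)) V := fun a ha =>
    ha.2.contDiffAt.comp_contDiffWithinAt a (hφV a ha)
  have hpow : ∀ i, ContDiffOn ℂ (⊤ : ℕ∞) (fun a => φ a ^ γ i) V := fun i a ha =>
    (analyticAt_id.cpow analyticAt_const (hφslit a ha.1)).contDiffAt.comp_contDiffWithinAt a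
      (hφV a ha)
  have hgJ := pderivSet_comp hV hφV (fun k => iteratedDeriv k g)
    (fun k a ha => hasDerivAt_iteratedDeriv ha.2 k) (by simpa using hgφ) ι Finset.univ h0V
  have hpowJ := fun h : Fin N => pderivSet_comp hV hφV
    (fun k w => fallFac (γ (ι h)) k * w ^ (γ (ι h) - (k : ℂ)))
    (fun k a ha => hasDerivAt_fallFac_mul_cpow _ k (hφslit a ha.1))
    (by simpa [fallFac] using hpow (ι h)) ι (Finset.univ.erase h) h0V
  have hsum := pderivSet_add_sum_coord_mul hV hgφ hpow ι Finset.univ h0V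
  have hnull : pderivSet ι Finset.univ (fun a => g (φ a) + ∑ i, a i * φ a ^ γ i) 0 = 0 :=
    (pderivList_congr hV (fun a ha => hzero a ha.1) _ h0V).trans
      (congrFun (pderivList_zero _) 0)
  simp only [iteratedDeriv_zero, hφ0] at hgJ
  simp only [Nat.cast_zero, sub_zero, hφ0] at hpowJ
  have hfall : ∀ z, fallFac z 0 = 1 := fun z => rfl
  simp only [hfall, one_mul] at hpowJ
  have hne : ∀ h : Fin N, (Finset.univ.erase h).Nonempty := fun h =>
    Finset.card_pos.1 (by
      rw [Finset.card_erase_of_mem (Finset.mem_univ h), Finset.card_univ, Fintype.card_fin]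
      omega)
  have hck : ∀ k, (Nat.factorial k : ℂ) * c k = iteratedDeriv k g α := fun k => by
    rw [hc, mul_div_cancel₀ _ (Nat.cast_ne_zero.2 k.factorial_ne_zero)]
  beta_reduce at hsum
  rw [hnull, hgJ, sum_allSetPartitions_eq_sum_Icc hUN (fun k => iteratedDeriv k g α)] at hsum
  simp only [Pi.zero_apply, zero_mul, Finset.sum_const_zero, add_zero, hpowJ] at hsum
  rw [Finset.sum_congr rfl fun h _ => sum_allSetPartitions_eq_sum_Icc (hne h)
    (fun k => fallFac (γ (ι h)) k * α ^ (γ (ι h) - (k : ℂ))) _] at hsum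
  simp only [Finset.card_erase_of_mem (Finset.mem_univ _), Finset.card_univ,
    Fintype.card_fin] at hsum
  have hone : setPartitions (Finset.univ : Finset (Fin N)) 1 = {{Finset.univ}} := by
    ext P
    rw [setPartitions_eq_filter, Finset.mem_filter, mem_allSetPartitions, Finset.card_eq_one,
      Finset.mem_singleton]
    constructor
    · rintro ⟨⟨-, -, h3⟩, B, rfl⟩
      congr 1
      ext x
      simpa using h3 x
    · rintro rfl
      simpa using hUN
  rw [← Finset.add_sum_Ioc_eq_sum_Icc (by omega : 1 ≤ N), hone, Finset.sum_singleton,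
    Finset.prod_singleton] at hsum
  have hIoc : Finset.Ioc 1 N = Finset.Icc 2 N := rfl
  simp only [partialOverSet_eq_pderivSet hV hφV h0V, hck]
  have hc1 : c 1 = iteratedDeriv 1 g α := by simpa using hck 1
  rw [hc1, hsum, hIoc]
  ring
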